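/- If an open set S ⊆ ℝ³ is 3D δ-sparse around x₀ at scale r (i.e. m(S ∩ B(x₀,r)) ≤ δ·m(B(x₀,r))), then there exist a scale ρ with 0 < ρ ≤ r and a unit vector d ∈ S² such that S is 1D δ^{1/3}-sparse around x₀ at scale ρ, i.e. m(S ∩ (x₀ − ρd, x₀ + ρd)) ≤ δ^{1/3} · 2ρ. -/

import Mathlib

open MeasureTheory Metric Set


/-- The set of (direction, radius) pairs whose product lies in `T`. -/
def polarSet (T : Set (EuclideanSpace ℝ (Fin 3))) :
    Set (sphere (0 : EuclideanSpace ℝ (Fin 3)) 1 × Ioi (0 : ℝ)) :=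
  {p | (p.2 : ℝ) • (p.1 : EuclideanSpace ℝ (Fin 3)) ∈ T}

lemma measurableSet_polarSet {T : Set (EuclideanSpace ℝ (Fin 3))} (hT : MeasurableSet T) :
    MeasurableSet (polarSet T) := by
  have : Measurable (fun p : sphere (0 : (EuclideanSpace ℝ (Fin 3))) 1 × Ioi (0 : ℝ) => (p.2 : ℝ) • (p.1 : (EuclideanSpace ℝ (Fin 3)))) := by
    have : Continuous (fun p : sphere (0 : (EuclideanSpace ℝ (Fin 3))) 1 × Ioi (0 : ℝ) => (p.2 : ℝ) • (p.1 : (EuclideanSpace ℝ (Fin 3)))) := by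
      fun_prop
    exact this.measurable
  exact this hT

lemma volume_polar {T : Set (EuclideanSpace ℝ (Fin 3))} (hT : MeasurableSet T) :
    volume T = ∫⁻ d, Measure.volumeIoiPow 2 (Prod.mk d ⁻¹' polarSet T)
      ∂(volume : Measure (EuclideanSpace ℝ (Fin 3))).toSphere := by
  have h := (volume : Measure (EuclideanSpace ℝ (Fin 3))).measurePreserving_homeomorphUnitSphereProd
  have hd : Module.finrank ℝ (EuclideanSpace ℝ (Fin 3)) - 1 = 2 := by simp
  rw [hd] at h
  rw [← Measure.prod_apply (measurableSet_polarSet hT),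
    ← h.measure_preimage (measurableSet_polarSet hT).nullMeasurableSet,
    comap_subtype_coe_apply (measurableSet_singleton _).compl]
  have : (homeomorphUnitSphereProd (EuclideanSpace ℝ (Fin 3))) ⁻¹' polarSet T = Subtype.val ⁻¹' T := by
    ext x
    have hx : ‖(x : (EuclideanSpace ℝ (Fin 3)))‖ ≠ 0 := norm_ne_zero_iff.2 x.2
    simp [polarSet, smul_smul, hx]
  rw [this, Subtype.image_preimage_coe, inter_comm, ← diff_eq,
    measure_sdiff_null (measure_singleton _)]

lemma ray_volume (P : Set ℝ) (hP : MeasurableSet P) :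
    Measure.volumeIoiPow 2 (Subtype.val ⁻¹' P) =
      ∫⁻ t in Ioi 0 ∩ P, ENNReal.ofReal (t ^ 2) := by
  rw [Measure.volumeIoiPow, withDensity_apply _ (measurable_subtype_coe hP),
    setLIntegral_subtype measurableSet_Ioi _ fun a : ℝ ↦ .ofReal (a ^ 2),
    Subtype.image_preimage_coe]

lemma bathtub (P : Set ℝ) (hP : MeasurableSet P) (a : ℝ) (ha : 0 < a) :
    ENNReal.ofReal (a ^ 3 / 3) + ENNReal.ofReal (a ^ 2) * volume (Ioi 0 ∩ P) ≤
      Measure.volumeIoiPow 2 (Subtype.val ⁻¹' P) + ENNReal.ofReal (a ^ 3) := by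
  have h1 : ENNReal.ofReal (a ^ 3 / 3) = ∫⁻ t in Ioi 0 ∩ Iio a, ENNReal.ofReal (t ^ 2) := by
    rw [← ray_volume _ measurableSet_Iio]
    have := Measure.volumeIoiPow_apply_Iio 2 ⟨a, ha⟩
    norm_num at this
    rw [← this]
    rfl
  have hQ : MeasurableSet (Ioi 0 ∩ P) := measurableSet_Ioi.inter hP
  have hI : MeasurableSet (Ioi (0:ℝ) ∩ Iio a) := measurableSet_Ioi.inter measurableSet_Iio
  have h2 : ENNReal.ofReal (a ^ 3) = ∫⁻ t in Ioi 0 ∩ Iio a, ENNReal.ofReal (a ^ 2) := by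
    rw [setLIntegral_const, Ioi_inter_Iio, Real.volume_Ioo, ← ENNReal.ofReal_mul (by positivity)]
    congr 1; ring
  have h3 : ENNReal.ofReal (a ^ 2) * volume (Ioi 0 ∩ P) =
      ∫⁻ t in Ioi 0 ∩ P, ENNReal.ofReal (a ^ 2) := by
    rw [setLIntegral_const]
  rw [h1, h2, h3, ray_volume P hP, ← lintegral_indicator hQ, ← lintegral_indicator hQ,
    ← lintegral_indicator hI, ← lintegral_indicator hI, ← lintegral_add_left, ← lintegral_add_left]
  · apply lintegral_mono
    intro t
    by_cases ht : t ∈ Ioi (0:ℝ)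
    · have ht' : 0 < t := ht
      by_cases htP : t ∈ P <;> by_cases hta : t < a <;>
        simp only [indicator, mem_inter_iff, ht, htP, hta, mem_Iio, and_self, and_true, and_false,
          if_true, if_false, zero_add, add_zero, le_refl, zero_le]
      · exact ENNReal.ofReal_le_ofReal (by push Not at hta; gcongr)
      · exact ENNReal.ofReal_le_ofReal (by gcongr)
    · simp [indicator, ht]
  · exact Measurable.indicator (by fun_prop) hQ
  · exact Measurable.indicator (by fun_prop) hI

/-- If an open set `S ⊆ ℝ³` is 3D `δ`-sparse around `x₀` at scale `r`, then there exist a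
scale `0 < ρ ≤ r` and a unit direction `d` such that `S` is 1D `δ^(1/3)`-sparse around `x₀`
at scale `ρ` (the 1D measure along the segment `(x₀ - ρd, x₀ + ρd)`). -/
theorem sparse3D_implies_sparse1D (S : Set (EuclideanSpace ℝ (Fin 3))) (hS : IsOpen S)
    (x₀ : EuclideanSpace ℝ (Fin 3)) (r δ : ℝ) (hr : 0 < r) (hδ : δ ∈ Set.Ioo (0:ℝ) 1)
    (hsparse : volume (S ∩ ball x₀ r) ≤ ENNReal.ofReal δ * volume (ball x₀ r)) :
    ∃ ρ : ℝ, 0 < ρ ∧ ρ ≤ r ∧ ∃ d : EuclideanSpace ℝ (Fin 3), ‖d‖ = 1 ∧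
      volume {t : ℝ | t ∈ Set.Ioo (-ρ) ρ ∧ x₀ + t • d ∈ S} ≤
        ENNReal.ofReal (δ ^ ((1:ℝ)/3) * (2 * ρ)) := by
  refine ⟨r, hr, le_rfl, ?_⟩
  by_contra! hcon
  obtain ⟨hδ0, -⟩ := hδ
  set c := δ ^ ((1:ℝ)/3) with hc
  have hc0 : 0 < c := by positivity
  have hc3 : c ^ 3 = δ := by
    rw [hc, ← Real.rpow_natCast, ← Real.rpow_mul hδ0.le]; norm_num
  set a := c * r with ha_def
  have ha : 0 < a := by positivity
  set T : Set (EuclideanSpace ℝ (Fin 3)) := (fun y => x₀ + y) ⁻¹' (S ∩ ball x₀ r) with hT_def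
  have hTm : MeasurableSet T :=
    (measurable_const_add x₀) (hS.inter isOpen_ball).measurableSet
  have hTv : volume T = volume (S ∩ ball x₀ r) := measure_preimage_add _ _ _
  have hN : MeasurableSet (-T) := hTm.neg
  have hNv : volume (-T) = volume T := Measure.measure_neg _ _
  have key : ∀ d : sphere (0 : (EuclideanSpace ℝ (Fin 3))) 1, ENNReal.ofReal (2 * a ^ 3 / 3) <
      Measure.volumeIoiPow 2 (Prod.mk d ⁻¹' polarSet T) +
      Measure.volumeIoiPow 2 (Prod.mk d ⁻¹' polarSet (-T)) := by
    intro d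
    have hd : ‖(d : (EuclideanSpace ℝ (Fin 3)))‖ = 1 := by simpa using d.2
    have hlt := hcon d hd
    set A : Set ℝ := {t : ℝ | t ∈ Set.Ioo (-r) r ∧ x₀ + t • (d : (EuclideanSpace ℝ (Fin 3))) ∈ S} with hA
    have hAT : A = (fun t : ℝ => t • (d : (EuclideanSpace ℝ (Fin 3)))) ⁻¹' T := by
      ext t
      simp [hA, hT_def, norm_smul, hd, abs_lt, and_comm]
    have hAm : MeasurableSet A := by
      rw [hAT]
      exact (by fun_prop : Measurable (fun t : ℝ => t • (d : (EuclideanSpace ℝ (Fin 3))))) hTm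
    have b1 := bathtub A hAm a ha
    have b2 := bathtub (-A) hAm.neg a ha
    have e1 : Prod.mk d ⁻¹' polarSet T = Subtype.val ⁻¹' A := by
      rw [hAT]; rfl
    have e2 : Prod.mk d ⁻¹' polarSet (-T) = Subtype.val ⁻¹' (-A) := by
      rw [hAT]; ext t; simp [polarSet]
    rw [e1, e2]
    have hvol : volume A ≤ volume (Ioi 0 ∩ A) + volume (Ioi 0 ∩ (-A)) := by
      have : volume (Ioi 0 ∩ (-A)) = volume (Iio 0 ∩ A) := by
        rw [← Measure.measure_neg]; congr 1; ext t; simp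
      rw [this]
      calc volume A ≤ volume (((Ioi 0 ∩ A) ∪ (Iio 0 ∩ A)) ∪ {0}) := by
            apply measure_mono
            intro t ht
            rcases lt_trichotomy t 0 with h | h | h <;> simp [h, ht]
        _ ≤ volume ((Ioi 0 ∩ A) ∪ (Iio 0 ∩ A)) + volume {(0:ℝ)} := measure_union_le _ _
        _ = volume ((Ioi 0 ∩ A) ∪ (Iio 0 ∩ A)) := by simp
        _ ≤ _ := measure_union_le _ _
    have hlt2 := hlt.trans_le hvol
    set X := Measure.volumeIoiPow 2 (Subtype.val ⁻¹' A)
    set Y := Measure.volumeIoiPow 2 (Subtype.val ⁻¹' (-A))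
    have hsum : ENNReal.ofReal (2 * a ^ 3 / 3) + ENNReal.ofReal (2 * a ^ 3) <
        X + Y + ENNReal.ofReal (2 * a ^ 3) := by
      calc ENNReal.ofReal (2 * a ^ 3 / 3) + ENNReal.ofReal (2 * a ^ 3)
          = ENNReal.ofReal (2 * a ^ 3 / 3) +
            ENNReal.ofReal (a ^ 2) * ENNReal.ofReal (c * (2 * r)) := by
            rw [← ENNReal.ofReal_mul (by positivity)]
            congr 2; rw [ha_def]; ring
        _ < ENNReal.ofReal (2 * a ^ 3 / 3) +
            ENNReal.ofReal (a ^ 2) * (volume (Ioi 0 ∩ A) + volume (Ioi 0 ∩ (-A))) := by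
            apply ENNReal.add_lt_add_left ENNReal.ofReal_ne_top
            exact (ENNReal.mul_lt_mul_iff_right (by simpa using ha.ne')
              ENNReal.ofReal_ne_top).2 hlt2
        _ = (ENNReal.ofReal (a ^ 3 / 3) + ENNReal.ofReal (a ^ 2) * volume (Ioi 0 ∩ A)) +
            (ENNReal.ofReal (a ^ 3 / 3) + ENNReal.ofReal (a ^ 2) * volume (Ioi 0 ∩ (-A))) := by
            have : 2 * a ^ 3 / 3 = a ^ 3 / 3 + a ^ 3 / 3 := by ring
            rw [this, ENNReal.ofReal_add (by positivity) (by positivity)]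
            ring
        _ ≤ _ := add_le_add b1 b2
        _ = _ := by
            have : 2 * a ^ 3 = a ^ 3 + a ^ 3 := by ring
            rw [this, ENNReal.ofReal_add (by positivity) (by positivity)]
            ring
    exact lt_of_add_lt_add_right hsum
  have hm1 := measurable_measure_prodMk_left (ν := Measure.volumeIoiPow 2)
    (measurableSet_polarSet hTm)
  have hm2 := measurable_measure_prodMk_left (ν := Measure.volumeIoiPow 2)
    (measurableSet_polarSet hN)
  have hfin := lintegral_strict_mono (μ := (volume : Measure (EuclideanSpace ℝ (Fin 3))).toSphere)
    (f := fun _ => ENNReal.ofReal (2 * a ^ 3 / 3))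
    (Measure.toSphere_ne_zero _) (hm1.add hm2).aemeasurable
    (by rw [lintegral_const]; exact ENNReal.mul_ne_top ENNReal.ofReal_ne_top (measure_ne_top _ _))
    (Filter.Eventually.of_forall key)
  simp only [Pi.add_apply] at hfin
  rw [lintegral_add_left hm1, ← volume_polar hTm, ← volume_polar hN, hNv, hTv, lintegral_const,
    Measure.toSphere_apply_univ] at hfin
  refine absurd (add_le_add hsparse hsparse) (not_le.2 (lt_of_eq_of_lt ?_ hfin))
  rw [Measure.addHaar_ball _ _ hr.le, finrank_euclideanSpace_fin, ← mul_assoc, ← mul_assoc,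
    ← add_mul, ← ENNReal.ofReal_natCast, ← ENNReal.ofReal_mul hδ0.le,
    ← ENNReal.ofReal_mul (by positivity), ← ENNReal.ofReal_add (by positivity) (by positivity)]
  congr 2
  rw [← hc3, ha_def]; push_cast; ring
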